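/- Let (C,D) be a regular inclusion. A bounded linear functional φ on C is a compatible eigenfunctional of norm one if and only if there exist v ∈ N(C,D) and a compatible state f ∈ 𝔖(C,D) with f(v*v) ≠ 0 such that φ = [v,f], i.e., φ(x) = f(v*x)/f(v*v)^{1/2} for all x ∈ C. -/

import Mathlib

open scoped ComplexOrder
open WeakDual
set_option linter.unusedSectionVars false

namespace RegularInclusion

variable {A : Type*} [NormedRing A] [StarRing A] [CStarRing A] [CompleteSpace A]
  [NormedAlgebra ℂ A] [StarModule ℂ A]

/-- The set of normalizers of the subalgebra `D` in `A`:
`N(A,D) = {v | v* D v ⊆ D and v D v* ⊆ D}`. -/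
def normSet (D : StarSubalgebra ℂ A) : Set A :=
  {v | (∀ d ∈ D, star v * d * v ∈ D) ∧ (∀ d ∈ D, v * d * star v ∈ D)}

lemma normSet.star_mul_self_mem {D : StarSubalgebra ℂ A} {v : A} (hv : v ∈ normSet D) :
    star v * v ∈ D := by simpa using hv.1 1 D.one_mem

lemma normSet.mul_star_self_mem {D : StarSubalgebra ℂ A} {v : A} (hv : v ∈ normSet D) :
    v * star v ∈ D := by simpa using hv.2 1 D.one_mem

/-- `D` is abelian. -/
def IsAbelian (D : StarSubalgebra ℂ A) : Prop := ∀ x ∈ D, ∀ y ∈ D, x * y = y * x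

/-- `(A, D)` is an inclusion: `D` is an abelian closed unital `C*`-subalgebra of `A`. -/
def IsInclusion (D : StarSubalgebra ℂ A) : Prop := IsAbelian D ∧ IsClosed (D : Set A)

/-- `(A, D)` is a regular inclusion: an inclusion for which the closed linear span of the
normalizers is all of `A`. -/
def IsRegularIncl (D : StarSubalgebra ℂ A) : Prop :=
  IsInclusion D ∧ closure (Submodule.span ℂ (normSet D) : Set A) = Set.univ

/-- `D` is a MASA in `A`: `D` is abelian and contains every element commuting with it. -/
def IsMasa (D : StarSubalgebra ℂ A) : Prop :=
  IsAbelian D ∧ ∀ x : A, (∀ d ∈ D, x * d = d * x) → x ∈ D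

/-- The relative commutant `D^c` of `D` in `A`. -/
def relComm (D : StarSubalgebra ℂ A) : StarSubalgebra ℂ A :=
  { Subalgebra.centralizer ℂ (D : Set A) with
    star_mem' := by
      intro x hx d hd
      have h := congrArg star (hx (star d) (star_mem hd))
      simpa [star_mul] using h.symm }

lemma mem_relComm {D : StarSubalgebra ℂ A} {x : A} :
    x ∈ relComm D ↔ ∀ d ∈ D, d * x = x * d := Iff.rfl

/-- `E : A → A` is a conditional expectation onto `D`. -/
structure IsCondExp [PartialOrder A] [StarOrderedRing A] (D : StarSubalgebra ℂ A)
    (E : A →ₗ[ℂ] A) : Prop where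
  mem : ∀ x : A, E x ∈ D
  idOn : ∀ d ∈ D, E d = d
  pos : ∀ x : A, 0 ≤ x → 0 ≤ E x
  bimod : ∀ d ∈ D, ∀ d' ∈ D, ∀ x : A, E (d * x * d') = d * E x * d'

/-- A linear map is faithful if `E (x* x) = 0` implies `x = 0`. -/
def Faithful (E : A →ₗ[ℂ] A) : Prop := ∀ x : A, E (star x * x) = 0 → x = 0

/-- `(A,D)` is a Cartan inclusion: a regular MASA inclusion admitting a faithful conditional
expectation onto `D`. -/
def IsCartanIncl [PartialOrder A] [StarOrderedRing A] (D : StarSubalgebra ℂ A) : Prop :=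
  IsRegularIncl D ∧ IsMasa D ∧ ∃ E : A →ₗ[ℂ] A, IsCondExp D E ∧ Faithful E

/-- The fixed-point set of the partial homeomorphism `β_v` of the character space of `D`:
those characters `σ` with `σ(v*v) > 0` and `σ(v* h v) = σ(h)·σ(v*v)` for all `h ∈ D`. -/
def fixBeta (D : StarSubalgebra ℂ A) {v : A} (hv : v ∈ normSet D) :
    Set (characterSpace ℂ ↥D) :=
  {σ | 0 < σ (⟨star v * v, normSet.star_mul_self_mem hv⟩ : D) ∧
    ∀ h : D, σ (⟨star v * (h : A) * v, hv.1 (h : A) h.2⟩ : D)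
      = σ h * σ (⟨star v * v, normSet.star_mul_self_mem hv⟩ : D)}

/-- A subset `S` of a topological algebra `B` is essential in `B` if the only closed two-sided
ideal of `B` meeting `S` trivially is the zero ideal. -/
def EssentialInSet (B : Type*) [NonUnitalNonAssocRing B] [TopologicalSpace B]
    (S : Set B) : Prop :=
  ∀ J : TwoSidedIdeal B, IsClosed (J : Set B) → (J : Set B) ∩ S = {0} → J = ⊥

section Two
variable {B : Type*} [NormedRing B] [StarRing B] [CStarRing B] [CompleteSpace B]
  [NormedAlgebra ℂ B] [StarModule ℂ B]

/-- A `*`-homomorphism between inclusions is regular if it maps `D` into `D₁` and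
normalizers to normalizers. -/
def IsRegularHom (D : StarSubalgebra ℂ A) (D₁ : StarSubalgebra ℂ B) (α : A →⋆ₐ[ℂ] B) : Prop :=
  (∀ d ∈ D, α d ∈ D₁) ∧ (∀ v ∈ normSet D, α v ∈ normSet D₁)

/-- `(B, D₁, α)` is a package for the regular inclusion `(A, D)`, witnessed by the faithful
conditional expectation `E₁`: `(B,D₁)` is a regular inclusion, `α` is an injective regular
`*`-homomorphism, `B` is generated as a `C*`-algebra by `α(A) ∪ E₁(α(A))` and `D₁` is
generated by `E₁(α(A))`. -/
def IsPackage [PartialOrder B] [StarOrderedRing B] (D : StarSubalgebra ℂ A)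
    (D₁ : StarSubalgebra ℂ B) (α : A →⋆ₐ[ℂ] B) (E₁ : B →ₗ[ℂ] B) : Prop :=
  IsRegularIncl D₁ ∧ Function.Injective α ∧ IsRegularHom D D₁ α ∧
    IsCondExp D₁ E₁ ∧ Faithful E₁ ∧
    (StarAlgebra.adjoin ℂ (Set.range ⇑α ∪ ⇑E₁ '' Set.range ⇑α)).topologicalClosure = ⊤ ∧
    (StarAlgebra.adjoin ℂ (⇑E₁ '' Set.range ⇑α)).topologicalClosure = D₁

/-- `(D₁, α|_D)` is an essential extension of `D`. -/
def EssentialExtIn (D : StarSubalgebra ℂ A) (D₁ : StarSubalgebra ℂ B) (α : A →⋆ₐ[ℂ] B) : Prop :=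
  EssentialInSet ↥D₁ {x : ↥D₁ | ∃ d ∈ D, α d = (x : B)}

/-- `(B, D₁, α)` is a Cartan envelope of `(A, D)`, witnessed by the faithful conditional
expectation `E₁`: a package for which `(B,D₁)` is moreover a Cartan inclusion (i.e. `D₁` is
a MASA in `B`) and `(D₁, α|_D)` is an essential extension of `D`. -/
def IsCartanEnvelope [PartialOrder B] [StarOrderedRing B] (D : StarSubalgebra ℂ A)
    (D₁ : StarSubalgebra ℂ B) (α : A →⋆ₐ[ℂ] B) (E₁ : B →ₗ[ℂ] B) : Prop :=
  IsPackage D D₁ α E₁ ∧ IsMasa D₁ ∧ EssentialExtIn D D₁ α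

end Two

/-- The set of normalizers of `Dα` relative to the subalgebra `Cα`. -/
def normSetRel (Cα Dα : StarSubalgebra ℂ A) : Set A :=
  {v | v ∈ Cα ∧ (∀ d ∈ Dα, star v * d * v ∈ Dα) ∧ (∀ d ∈ Dα, v * d * star v ∈ Dα)}

/-- `φ` is an eigenfunctional for `(A,D)` with range character `r` and source character `s`. -/
def IsEigen (D : StarSubalgebra ℂ A) (φ : A →L[ℂ] ℂ) (r s : ↥D →ₐ[ℂ] ℂ) : Prop :=
  φ ≠ 0 ∧ ∀ (d₁ d₂ : D) (x : A), φ ((d₁ : A) * x * (d₂ : A)) = r d₁ * φ x * s d₂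

/-- `f` is a state on `A`. -/
def IsState (f : A →ₗ[ℂ] ℂ) : Prop := f 1 = 1 ∧ ∀ x : A, 0 ≤ f (star x * x)

/-- `f ∈ Mod(A,D)`: a state whose restriction to `D` is multiplicative (hence a character). -/
def InMod (D : StarSubalgebra ℂ A) (f : A →ₗ[ℂ] ℂ) : Prop :=
  IsState f ∧ ∀ d₁ d₂ : D, f ((d₁ : A) * (d₂ : A)) = f (d₁ : A) * f (d₂ : A)

/-- `f` is a compatible state: a state with `|f(v)|² ∈ {0, f(v*v)}` for every normalizer `v`. -/
def IsCompatState (D : StarSubalgebra ℂ A) (f : A →ₗ[ℂ] ℂ) : Prop :=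
  IsState f ∧ ∀ v ∈ normSet D, f v = 0 ∨ (Complex.normSq (f v) : ℂ) = f (star v * v)

/-- `φ` is a compatible eigenfunctional: `|φ(v)|² ∈ {0, s(φ)(v*v)}` for every normalizer `v`. -/
def IsCompatEigen (D : StarSubalgebra ℂ A) (φ : A →L[ℂ] ℂ) (r s : ↥D →ₐ[ℂ] ℂ) : Prop :=
  IsEigen D φ r s ∧ ∀ v, ∀ hv : v ∈ normSet D,
    φ v = 0 ∨ (Complex.normSq (φ v) : ℂ)
      = s (⟨star v * v, normSet.star_mul_self_mem hv⟩ : D)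

/-- The eigenfunctional `[v,f] : x ↦ f(v* x) / f(v* v)^{1/2}`. -/
noncomputable def evf (f : A →ₗ[ℂ] ℂ) (v : A) (x : A) : ℂ :=
  f (star v * x) / (Real.sqrt (f (star v * v)).re : ℂ)

/-- A bundled unital `C*`-algebra (with its canonical partial order). -/
structure CSA where
  carrier : Type
  [nr : NormedRing carrier]
  [sr : StarRing carrier]
  [cs : CStarRing carrier]
  [cp : CompleteSpace carrier]
  [na : NormedAlgebra ℂ carrier]
  [sm : StarModule ℂ carrier]
  [po : PartialOrder carrier]
  [sor : StarOrderedRing carrier]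

attribute [instance] CSA.nr CSA.sr CSA.cs CSA.cp CSA.na CSA.sm CSA.po CSA.sor

end RegularInclusion

namespace RegularInclusion

variable {A : Type*} [NormedRing A] [StarRing A] [CStarRing A] [CompleteSpace A]
  [NormedAlgebra ℂ A] [StarModule ℂ A]

section States

variable {f : A →ₗ[ℂ] ℂ}

lemma IsState.map_star (hf : IsState f) (x : A) : f (star x) = star (f x) := by
  have h1 := (Complex.nonneg_iff.1 (hf.2 (1 + x))).2
  have h2 := (Complex.nonneg_iff.1 (hf.2 (1 + Complex.I • x))).2
  have h3 := (Complex.nonneg_iff.1 (hf.2 x)).2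
  simp only [star_add, star_one, star_smul, add_mul, mul_add, one_mul, mul_one, smul_mul_assoc,
    mul_smul_comm, map_add, map_smul, hf.1, smul_eq_mul, Complex.add_im,
    Complex.one_im, Complex.mul_im, Complex.mul_re, Complex.star_def, Complex.conj_I,
    Complex.neg_re, Complex.neg_im, Complex.I_re, Complex.I_im] at h1 h2
  apply Complex.ext <;> simp only [Complex.star_def, Complex.conj_re, Complex.conj_im] <;> linarith

/-- The positive semidefinite sesquilinear form `(x, y) ↦ f (x* y)` of a state `f`. -/
noncomputable abbrev IsState.preInner (hf : IsState f) : PreInnerProductSpace.Core ℂ A where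
  inner x y := f (star x * y)
  conj_inner_symm x y := by simp [starRingEnd_apply, ← hf.map_star]
  re_inner_nonneg x := (Complex.nonneg_iff.1 (hf.2 x)).1
  add_left x y z := by rw [star_add, add_mul, map_add]
  smul_left x y z := by simp

lemma IsState.cauchy_schwarz (hf : IsState f) (x y : A) :
    ‖f (star x * y)‖ ^ 2 ≤ (f (star x * x)).re * (f (star y * y)).re := by
  have h := @InnerProductSpace.Core.inner_mul_inner_self_le ℂ A _ _ _ hf.preInner x y
  have h' : ‖f (star y * x)‖ = ‖f (star x * y)‖ := by
    rw [← norm_star, ← hf.map_star]; simp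
  calc ‖f (star x * y)‖ ^ 2 = ‖f (star x * y)‖ * ‖f (star y * x)‖ := by rw [h', sq]
    _ ≤ _ := h

lemma IsState.eq_re (hf : IsState f) (x : A) :
    f (star x * x) = ((f (star x * x)).re : ℂ) :=
  Complex.ext rfl (Complex.nonneg_iff.1 (hf.2 x)).2.symm

lemma IsState.re_le (hf : IsState f) (x : A) : (f (star x * x)).re ≤ ‖x‖ ^ 2 := by
  let _ : CStarAlgebra A := {}
  let _ := CStarAlgebra.spectralOrder A
  have := CStarAlgebra.spectralOrderedRing A
  have h : star x * x ≤ algebraMap ℝ A (‖x‖ ^ 2) := CStarAlgebra.star_mul_le_algebraMap_norm_sq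
  obtain ⟨z, hz⟩ := CStarAlgebra.nonneg_iff_eq_star_mul_self.1 (sub_nonneg.2 h)
  have h1 := (Complex.nonneg_iff.1 (hf.2 z)).1
  have h2 : algebraMap ℝ A (‖x‖ ^ 2) = ((‖x‖ ^ 2 : ℝ) : ℂ) • (1 : A) := by
    rw [Algebra.algebraMap_eq_smul_one, Complex.coe_smul]
  rw [← hz, map_sub, h2, map_smul, hf.1, smul_eq_mul, mul_one, Complex.sub_re,
    Complex.ofReal_re] at h1
  linarith

lemma isState_of_contractive (h1 : f 1 = 1) (hf : ∀ x, ‖f x‖ ≤ ‖x‖) : IsState f := by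
  let _ : CStarAlgebra A := {}
  let _ := CStarAlgebra.spectralOrder A
  have := CStarAlgebra.spectralOrderedRing A
  have : Nontrivial A := ⟨⟨1, 0, fun h => by simp [h] at h1⟩⟩
  refine ⟨h1, fun x => ?_⟩
  set a := star x * x with ha
  have hsa : star a = a := by simp [ha]
  have hnn : 0 ≤ a := star_mul_self_nonneg x
  have key : ∀ t : ℝ, ((f a).im + t) ^ 2 ≤ ‖a‖ ^ 2 + t ^ 2 := by
    intro t
    have hb := hf (a + ((t : ℂ) * Complex.I) • (1 : A))
    have hb1 : ‖a + ((t : ℂ) * Complex.I) • (1 : A)‖ ^ 2 ≤ ‖a‖ ^ 2 + t ^ 2 := by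
      rw [sq, ← CStarRing.norm_star_mul_self]
      have : star (a + ((t : ℂ) * Complex.I) • (1 : A)) * (a + ((t : ℂ) * Complex.I) • (1 : A))
          = a * a + ((t : ℂ) ^ 2) • (1 : A) := by
        have hI : (t : ℂ) * Complex.I * ((t : ℂ) * Complex.I) = - (t : ℂ) ^ 2 := by
          rw [mul_mul_mul_comm, Complex.I_mul_I]; ring
        simp only [star_add, hsa, star_smul, star_one, Complex.star_def, map_mul,
          Complex.conj_ofReal, Complex.conj_I, add_mul, mul_add, smul_mul_assoc, mul_smul_comm,
          one_mul, mul_one, mul_neg, neg_smul, neg_mul]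
        rw [smul_add, smul_neg, smul_smul, hI]
        module
      rw [this]
      refine (norm_add_le _ _).trans (add_le_add ?_ ?_)
      · rw [sq]; exact norm_mul_le _ _
      · rw [norm_smul]; simp
    have hb2 : ((f a).im + t) ^ 2 ≤ ‖f (a + ((t : ℂ) * Complex.I) • (1 : A))‖ ^ 2 := by
      have := Complex.abs_im_le_norm (f (a + ((t : ℂ) * Complex.I) • (1 : A)))
      rw [← sq_abs]
      refine pow_le_pow_left₀ (abs_nonneg _) ?_ 2
      simpa [h1] using this
    exact hb2.trans ((pow_le_pow_left₀ (norm_nonneg _) hb 2).trans hb1)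
  have him : (f a).im = 0 := by
    by_contra hne
    have h := key ((‖a‖ ^ 2 + 1) / (f a).im)
    have e : ((f a).im + (‖a‖ ^ 2 + 1) / (f a).im) ^ 2
        = (f a).im ^ 2 + 2 * (‖a‖ ^ 2 + 1) + ((‖a‖ ^ 2 + 1) / (f a).im) ^ 2 := by
      field_simp
      ring
    rw [e] at h
    nlinarith [sq_nonneg (f a).im, sq_nonneg ‖a‖]
  have hle : ‖(‖a‖ : ℂ) • (1 : A) - a‖ ≤ ‖a‖ := by
    have e : (‖a‖ : ℂ) • (1 : A) = algebraMap ℝ A ‖a‖ := by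
      rw [Algebra.algebraMap_eq_smul_one, Complex.coe_smul]
    have h0 : a ≤ algebraMap ℝ A ‖a‖ := IsSelfAdjoint.le_algebraMap_norm_self hsa
    rw [e, CStarAlgebra.norm_le_iff_le_algebraMap _ (norm_nonneg a) (sub_nonneg.2 h0)]
    exact sub_le_self _ hnn
  have hre := (Complex.abs_re_le_norm _).trans ((hf _).trans hle)
  rw [map_sub, map_smul, h1] at hre
  simp only [smul_eq_mul, mul_one, Complex.sub_re, Complex.ofReal_re] at hre
  refine Complex.nonneg_iff.2 ⟨?_, him.symm⟩
  linarith [(abs_le.1 hre).2]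

end States

section Normalizers

variable {D : StarSubalgebra ℂ A}

lemma normSet.mul_mem {u v : A} (hu : u ∈ normSet D) (hv : v ∈ normSet D) : u * v ∈ normSet D := by
  refine ⟨fun d hd => ?_, fun d hd => ?_⟩
  · simpa [mul_assoc] using hv.1 _ (hu.1 d hd)
  · simpa [mul_assoc] using hu.2 _ (hv.2 d hd)

lemma normSet.star_mem {v : A} (hv : v ∈ normSet D) : star v ∈ normSet D :=
  ⟨fun d hd => by simpa using hv.2 d hd, fun d hd => by simpa using hv.1 d hd⟩

lemma mem_normSet_of_mem {d : A} (hd : d ∈ D) : d ∈ normSet D :=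
  ⟨fun _ he => mul_mem (mul_mem (star_mem hd) he) hd,
    fun _ he => mul_mem (mul_mem hd he) (star_mem hd)⟩

/-- A normalizer `v` can be rescaled by an element of `D` to a contraction without losing mass
at a character `s` with `s (v* v) = c > 0`. -/
lemma exists_mul_contractive (hD : IsClosed (D : Set A)) (s : ↥D →ₐ[ℂ] ℂ) {v : A}
    (hv : v ∈ normSet D) {c : ℝ} (hc : 0 < c)
    (hs : s ⟨star v * v, normSet.star_mul_self_mem hv⟩ = c) :
    ∃ d : D, ‖v * (d : A)‖ ≤ 1 ∧ s d = ((√c)⁻¹ : ℝ) := by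
  let _ : CStarAlgebra A := {}
  have : IsClosed (D : Set A) := hD
  let _ : CStarAlgebra D := StarSubalgebra.cstarAlgebra D
  set a : D := ⟨star v * v, normSet.star_mul_self_mem hv⟩ with ha
  have hsa : IsSelfAdjoint a := Subtype.ext (by simp [ha])
  let g : ℝ → ℝ := fun t => (√(max |t| c))⁻¹
  have hpos : ∀ t : ℝ, 0 < √(max |t| c) := fun t => Real.sqrt_pos.2 (lt_max_of_lt_right hc)
  have hg : Continuous g := Continuous.inv₀ (by fun_prop) fun t => (hpos t).ne'
  refine ⟨cfc g a, ?_, ?_⟩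
  · have hstar : star (cfc g a) = cfc g a := cfc_predicate g a
    have e : star (v * (cfc g a : D).1) * (v * (cfc g a : D).1)
        = ((cfc (fun t => g t * t * g t) a : D) : A) := by
      rw [cfc_mul (fun t => g t * t) g a (by fun_prop) (by fun_prop),
        cfc_mul g (fun t => t) a (by fun_prop) (by fun_prop), cfc_id' ℝ a hsa]
      have h2 : star ((cfc g a : D) : A) = (cfc g a : D) := congrArg Subtype.val hstar
      rw [star_mul, h2]
      simp [a, mul_assoc]
    have h3 : ‖(cfc (fun t => g t * t * g t) a : D)‖ ≤ 1 := by
      refine norm_cfc_le zero_le_one fun t _ => ?_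
      have h4 : g t * t * g t = t / max |t| c := by
        have := Real.mul_self_sqrt (le_max_of_le_right hc.le : 0 ≤ max |t| c)
        rw [div_eq_mul_inv, ← this, mul_inv]
        ring
      rw [h4, norm_div, Real.norm_eq_abs, Real.norm_eq_abs,
        abs_of_pos (lt_max_of_lt_right hc : 0 < max |t| c)]
      exact div_le_one_of_le₀ (le_max_left _ _) (le_max_of_le_right hc.le)
    have h6 : ‖v * (cfc g a : D).1‖ * ‖v * (cfc g a : D).1‖ ≤ 1 := by
      rw [← CStarRing.norm_star_mul_self, e]
      exact h3
    nlinarith [norm_nonneg (v * (cfc g a : D).1)]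
  · have := AlgHomClass.instStarHomClass (F := ↥D →ₐ[ℂ] ℂ) (A := D)
    have hcont : Continuous s := map_continuous s
    rw [StarAlgHomClass.map_cfc (S := ℂ) s g a (by fun_prop) hcont hsa (hsa.map s), hs]
    have : (c : ℂ) = algebraMap ℝ ℂ c := rfl
    rw [this, cfc_algebraMap]
    simp [g, abs_of_pos hc]

end Normalizers

section Eigenfunctionals

variable {D : StarSubalgebra ℂ A} {φ : A →L[ℂ] ℂ} {r s : ↥D →ₐ[ℂ] ℂ}

lemma IsEigen.map_mul_left (h : IsEigen D φ r s) {d : A} (hd : d ∈ D) (x : A) :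
    φ (d * x) = r ⟨d, hd⟩ * φ x := by
  simpa using h.2 ⟨d, hd⟩ 1 x

lemma IsEigen.map_mul_right (h : IsEigen D φ r s) (x : A) {d : A} (hd : d ∈ D) :
    φ (x * d) = φ x * s ⟨d, hd⟩ := by
  simpa using h.2 1 ⟨d, hd⟩ x

lemma IsEigen.source_conj (h : IsEigen D φ r s) {u : A} (hu : u ∈ normSet D) (hne : φ u ≠ 0)
    {d : A} (hd : d ∈ D) :
    s ⟨star u * d * u, hu.1 d hd⟩
      = r ⟨d, hd⟩ * s ⟨star u * u, normSet.star_mul_self_mem hu⟩ := by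
  have h1 : ∀ {e : A} (he : e ∈ D), s ⟨star u * e * u, hu.1 e he⟩
      = r ⟨u * star u, normSet.mul_star_self_mem hu⟩ * r ⟨e, he⟩ := by
    intro e he
    apply mul_left_cancel₀ hne
    rw [← h.map_mul_right, ← mul_assoc, ← mul_assoc, mul_assoc (u * star u),
      h.map_mul_left (normSet.mul_star_self_mem hu), h.map_mul_left he]
    ring
  have h2 := h1 D.one_mem
  have h3 : r ⟨1, D.one_mem⟩ = 1 := map_one r
  simp only [mul_one, h3] at h2
  rw [h1 hd, h2, mul_comm]

lemma IsRegularIncl.exists_normalizer_ne_zero (hreg : IsRegularIncl D) (hφ : φ ≠ 0) :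
    ∃ v ∈ normSet D, φ v ≠ 0 := by
  by_contra! hcon
  apply hφ
  refine ContinuousLinearMap.ext_on (s := normSet D) ?_ fun v hv => by simpa using hcon v hv
  exact dense_iff_closure_eq.2 hreg.2

lemma IsCompatEigen.exists_normalizer_contractive (hreg : IsRegularIncl D)
    (h : IsCompatEigen D φ r s) : ∃ w ∈ normSet D, ‖w‖ ≤ 1 ∧ φ w = 1 := by
  obtain ⟨v, hv, hne⟩ := hreg.exists_normalizer_ne_zero h.1.1
  have hs := ((h.2 v hv).resolve_left hne).symm
  have hc : 0 < Complex.normSq (φ v) := Complex.normSq_pos.2 hne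
  obtain ⟨d, hd1, hd2⟩ := exists_mul_contractive hreg.1.2 s hv hc hs
  have hn : ‖φ (v * d)‖ = 1 := by
    rw [h.1.map_mul_right v d.2, norm_mul, hd2, Complex.normSq_eq_norm_sq,
      Real.sqrt_sq (norm_nonneg _)]
    simp [hne]
  have hne' : φ (v * d) ≠ 0 := fun h0 => by simp [h0] at hn
  refine ⟨v * ((φ (v * d))⁻¹ • (d : A)),
    normSet.mul_mem hv (mem_normSet_of_mem (D.smul_mem d.2 _)), ?_, ?_⟩
  · rw [mul_smul_comm, norm_smul, norm_inv, hn]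
    simpa using hd1
  · rw [mul_smul_comm, map_smul, smul_eq_mul, inv_mul_cancel₀ hne']

lemma IsCompatEigen.exists_eq_evf (hreg : IsRegularIncl D) (h : IsCompatEigen D φ r s)
    (hφ : ‖φ‖ = 1) :
    ∃ v ∈ normSet D, ∃ f : A →ₗ[ℂ] ℂ, IsCompatState D f ∧
      f (star v * v) ≠ 0 ∧ ∀ x : A, φ x = evf f v x := by
  obtain ⟨w, hw, hw1, hφw⟩ := h.exists_normalizer_contractive hreg
  have hs : s ⟨star w * w, normSet.star_mul_self_mem hw⟩ = 1 := by
    have := h.2 w hw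
    simpa [hφw, eq_comm] using this
  have hww : φ (w * (star w * w)) = 1 := by
    rw [h.1.map_mul_right w (normSet.star_mul_self_mem hw), hφw, hs, one_mul]
  have hr : r ⟨w * star w, normSet.mul_star_self_mem hw⟩ = 1 := by
    rw [← mul_assoc, h.1.map_mul_left (normSet.mul_star_self_mem hw), hφw, mul_one] at hww
    exact hww
  let f : A →ₗ[ℂ] ℂ := (φ : A →ₗ[ℂ] ℂ) ∘ₗ LinearMap.mulLeft ℂ w
  have hf : ∀ x, f x = φ (w * x) := fun _ => rfl
  have hstate : IsState f := by
    refine isState_of_contractive (by rw [hf, mul_one, hφw]) fun x => ?_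
    calc ‖f x‖ ≤ ‖φ‖ * ‖w * x‖ := φ.le_opNorm _
      _ ≤ 1 * ‖x‖ := by
        rw [hφ, one_mul, one_mul]
        exact (norm_mul_le _ _).trans (mul_le_of_le_one_left (norm_nonneg _) hw1)
      _ = ‖x‖ := one_mul _
  refine ⟨w, hw, f, ⟨hstate, fun u hu => ?_⟩, ?_, fun x => ?_⟩
  · refine or_iff_not_imp_left.2 fun hne => ?_
    rw [hf] at hne
    have hu2 := (h.2 _ (normSet.mul_mem hw hu)).resolve_left hne
    have hfu : f (star u * u) = s ⟨star u * u, normSet.star_mul_self_mem hu⟩ := by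
      rw [hf, h.1.map_mul_right w (normSet.star_mul_self_mem hu), hφw, one_mul]
    rw [hf, hu2, hfu]
    have huu := normSet.mul_star_self_mem hu
    apply mul_left_cancel₀ hne
    rw [← h.1.map_mul_right, ← h.1.map_mul_right]
    have e1 : w * u * (star (w * u) * (w * u)) = w * (u * star u) * star w * (w * u) := by
      simp only [star_mul, mul_assoc]
    have e2 : w * star w * (w * u * (star u * u)) = w * (u * star u) * star w * (w * u) := by
      have hcomm := hreg.1.1 _ (normSet.star_mul_self_mem hw) _ huu
      calc _ = w * (star w * w * (u * star u)) * u := by simp only [mul_assoc]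
        _ = _ := by rw [hcomm]; simp only [mul_assoc]
    rw [e1, ← e2, h.1.map_mul_left (normSet.mul_star_self_mem hw), hr, one_mul]
  · rw [hf, hww]; exact one_ne_zero
  · rw [evf, hf, hf, hww, ← mul_assoc, h.1.map_mul_left (normSet.mul_star_self_mem hw), hr]
    simp

end Eigenfunctionals

section CompatibleStates

variable {D : StarSubalgebra ℂ A} {f : A →ₗ[ℂ] ℂ}

lemma IsCompatState.map_star_mul_self_eq_zero (hf : IsCompatState D f) {d : A} (hd : d ∈ D)
    (h0 : f d = 0) : f (star d * d) = 0 := by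
  have h := hf.2 (1 + d) (mem_normSet_of_mem (add_mem D.one_mem hd))
  have h1 : f (star d) = 0 := by rw [hf.1.map_star, h0, star_zero]
  simpa [add_mul, mul_add, hf.1.1, h0, h1] using h

lemma IsCompatState.map_mul_right (hf : IsCompatState D f) (x : A) {d : A} (hd : d ∈ D) :
    f (x * d) = f x * f d := by
  have h0 : f (d - f d • (1 : A)) = 0 := by simp [hf.1.1]
  have h1 := hf.map_star_mul_self_eq_zero (sub_mem hd (D.smul_mem D.one_mem (f d))) h0
  have h2 := hf.1.cauchy_schwarz (star x) (d - f d • (1 : A))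
  rw [h1, Complex.zero_re, mul_zero, star_star] at h2
  have h3 : f (x * (d - f d • (1 : A))) = 0 :=
    norm_eq_zero.1 (pow_eq_zero_iff two_ne_zero |>.1 (le_antisymm h2 (sq_nonneg _)))
  rw [mul_sub, mul_smul_comm, mul_one, map_sub, map_smul, sub_eq_zero, smul_eq_mul] at h3
  rw [h3, mul_comm]

/-- The restriction of a compatible state to `D`, as a character. -/
noncomputable def IsCompatState.source (hf : IsCompatState D f) : ↥D →ₐ[ℂ] ℂ :=
  AlgHom.ofLinearMap (f ∘ₗ D.toSubalgebra.toSubmodule.subtype) hf.1.1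
    fun x y => hf.map_mul_right (x : A) y.2

lemma IsCompatState.source_apply (hf : IsCompatState D f) (d : D) : hf.source d = f d := rfl

/-- The character `d ↦ f (v* d v) / f (v* v)` of `D`. -/
noncomputable def IsCompatState.range (hf : IsCompatState D f) (hD : IsAbelian D) {v : A}
    (hv : v ∈ normSet D) (hne : f (star v * v) ≠ 0) : ↥D →ₐ[ℂ] ℂ :=
  AlgHom.ofLinearMap ((f (star v * v))⁻¹ • (f ∘ₗ LinearMap.mulRight ℂ v ∘ₗ
      LinearMap.mulLeft ℂ (star v) ∘ₗ D.toSubalgebra.toSubmodule.subtype))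
    (by
      change (f (star v * v))⁻¹ * f (star v * 1 * v) = 1
      rw [mul_one, inv_mul_cancel₀ hne])
    (fun x y => by
      change (f (star v * v))⁻¹ * f (star v * (x * y) * v)
        = (f (star v * v))⁻¹ * f (star v * x * v) * ((f (star v * v))⁻¹ * f (star v * y * v))
      have h1 := hf.map_mul_right (star v * (x * y) * v) (normSet.star_mul_self_mem hv)
      have h2 := hf.map_mul_right (star v * x * v) (hv.1 y y.2)
      have e : star v * (x * y : A) * v * (star v * v) = star v * x * v * (star v * y * v) := by
        have := hD _ (normSet.mul_star_self_mem hv) _ y.2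
        calc _ = star v * x * (y * (v * star v)) * v := by simp only [mul_assoc]
          _ = _ := by rw [← this]; simp only [mul_assoc]
      rw [e, h2] at h1
      field_simp
      rw [mul_comm, ← h1])

lemma IsCompatState.range_apply (hf : IsCompatState D f) (hD : IsAbelian D) {v : A}
    (hv : v ∈ normSet D) (hne : f (star v * v) ≠ 0) (d : D) :
    hf.range hD hv hne d = (f (star v * v))⁻¹ * f (star v * d * v) := rfl

lemma IsCompatState.map_mul_left (hf : IsCompatState D f) {d : A} (hd : d ∈ D) (x : A) :
    f (d * x) = f d * f x := by
  have h := hf.map_mul_right (star x) (star_mem hd)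
  rw [← star_mul, hf.1.map_star, hf.1.map_star, hf.1.map_star] at h
  simpa [mul_comm] using congrArg star h

lemma IsCompatState.isCompatEigen (hf : IsCompatState D f) (hD : IsInclusion D) {v : A}
    (hv : v ∈ normSet D) (hne : f (star v * v) ≠ 0) {φ : A →L[ℂ] ℂ}
    (hφ : ∀ x, φ x = evf f v x) :
    IsCompatEigen D φ (hf.range hD.1 hv hne) hf.source ∧ ‖φ‖ = 1 := by
  set c : ℝ := (f (star v * v)).re
  have hfc : f (star v * v) = c := hf.1.eq_re v
  have hc : 0 < c := by
    refine lt_of_le_of_ne (Complex.nonneg_iff.1 (hf.1.2 v)).1 fun h0 => hne ?_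
    rw [hfc, ← h0, Complex.ofReal_zero]
  have hk : 0 < √c := Real.sqrt_pos.2 hc
  have hkk : √c * √c = c := Real.mul_self_sqrt hc.le
  have hφ' : ∀ x, φ x = f (star v * x) / (√c : ℝ) := hφ
  have hkC : ((√c : ℝ) : ℂ) ≠ 0 := Complex.ofReal_ne_zero.2 hk.ne'
  have hφv : φ v = (√c : ℝ) := by
    rw [hφ', hfc, div_eq_iff hkC, ← Complex.ofReal_mul, hkk]
  have heig : IsEigen D φ (hf.range hD.1 hv hne) hf.source := by
    refine ⟨fun h0 => hkC ?_, fun d₁ d₂ x => ?_⟩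
    · rw [← hφv, h0]; rfl
    · rw [hφ', hφ', hf.range_apply, hf.source_apply, ← mul_assoc, hf.map_mul_right _ d₂.2]
      have h1 := hf.map_mul_left (normSet.star_mul_self_mem hv) (star v * (d₁ * x))
      have h2 := hf.map_mul_left (hv.1 d₁ d₁.2) (star v * x)
      have e : star v * v * (star v * (d₁ * x)) = star v * d₁ * v * (star v * x) := by
        have := hD.1 _ (normSet.mul_star_self_mem hv) _ d₁.2
        calc _ = star v * (v * star v * d₁) * x := by simp only [mul_assoc]
          _ = _ := by rw [this]; simp only [mul_assoc]
      rw [e, h2] at h1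
      have h3 : f (star v * (d₁ * x))
          = (f (star v * v))⁻¹ * f (star v * d₁ * v) * f (star v * x) := by
        field_simp
        rw [h1, mul_comm]
      rw [h3]
      ring
  refine ⟨⟨heig, fun u hu => ?_⟩, le_antisymm ?_ ?_⟩
  · refine or_iff_not_imp_left.2 fun hu0 => ?_
    have hfu : f (star v * u) ≠ 0 := fun h0 => hu0 (by rw [hφ', h0, zero_div])
    have h1 := (hf.2 _ (normSet.mul_mem (normSet.star_mem hv) hu)).resolve_left hfu
    have h2 := heig.source_conj hu hu0 (normSet.mul_star_self_mem hv)
    have h3 := hf.map_mul_right (star v * v) (normSet.star_mul_self_mem hv)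
    rw [hf.source_apply, hf.range_apply] at h2
    have e1 : star (star v * u) * (star v * u) = star u * (v * star v) * u := by
      simp only [star_mul, star_star, mul_assoc]
    have e2 : star v * (v * star v) * v = star v * v * (star v * v) := by simp only [mul_assoc]
    rw [e1, h2] at h1
    simp only [e2, h3] at h1
    rw [inv_mul_cancel_left₀ hne, hfc] at h1
    rw [hφ', Complex.normSq_div, Complex.normSq_ofReal, hkk, Complex.ofReal_div, h1,
      mul_div_cancel_left₀ _ (Complex.ofReal_ne_zero.2 hc.ne')]
  · refine φ.opNorm_le_bound zero_le_one fun x => ?_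
    have h1 := hf.1.cauchy_schwarz v x
    have h2 := hf.1.re_le x
    rw [one_mul, hφ', norm_div, Complex.norm_real, Real.norm_of_nonneg hk.le, div_le_iff₀ hk]
    refine le_of_sq_le_sq ?_ (by positivity)
    rw [mul_pow, Real.sq_sqrt hc.le]
    nlinarith
  · obtain ⟨d, hd1, hd2⟩ := exists_mul_contractive hD.2 hf.source hv hc hfc
    have h1 : φ (v * d) = 1 := by
      rw [heig.map_mul_right v d.2, hφv]
      change ((√c : ℝ) : ℂ) * hf.source d = 1
      rw [hd2, ← Complex.ofReal_mul, mul_inv_cancel₀ hk.ne', Complex.ofReal_one]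
    calc (1 : ℝ) = ‖φ (v * d)‖ := by rw [h1, norm_one]
      _ ≤ ‖φ‖ * ‖v * (d : A)‖ := φ.le_opNorm _
      _ ≤ ‖φ‖ := mul_le_of_le_one_right (norm_nonneg _) hd1

end CompatibleStates

/-- a bounded linear functional `φ` on `A` is a norm-one compatible
eigenfunctional iff `φ = [v,f]` for some normalizer `v` and some compatible state `f` with
`f(v*v) ≠ 0`. -/
theorem stmt17 (D : StarSubalgebra ℂ A) (hreg : IsRegularIncl D) (φ : A →L[ℂ] ℂ) :
    ((∃ r s : ↥D →ₐ[ℂ] ℂ, IsCompatEigen D φ r s) ∧ ‖φ‖ = 1)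
      ↔ ∃ v ∈ normSet D, ∃ f : A →ₗ[ℂ] ℂ, IsCompatState D f ∧
          f (star v * v) ≠ 0 ∧ ∀ x : A, φ x = evf f v x := by
  constructor
  · rintro ⟨⟨r, s, h⟩, hφ⟩
    exact h.exists_eq_evf hreg hφ
  · rintro ⟨v, hv, f, hf, hne, hφ⟩
    have h := hf.isCompatEigen hreg.1 hv hne hφ
    exact ⟨⟨_, _, h.1⟩, h.2⟩

end RegularInclusion
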